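/- arXiv:2301.02177 — 3 statements merged into one kernel-verified Lean document; each statement's English description precedes it below -/
import Mathlib

section
/- Let G be a graph and let v, w be distinct non-adjacent vertices. Then the graph G^⋆ has exactly as many stable sets as G: |SSS(G^⋆)| = |SSS(G)|. Explicitly, stable sets of G^⋆ not containing z^⋆ are stable sets of G not containing both v and w, and the map S ↦ (S \ {z^⋆}) ∪ {v, w} bijects stable sets of G^⋆ containing z^⋆ with stable sets of G containing both v and w. -/
open scoped Classical

noncomputable section

/-- `S` is a stable set of `G`: its vertices are pairwise non-adjacent. -/
def IsStableSet {V : Type*} (G : SimpleGraph V) (S : Finset V) : Prop :=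
  ∀ a ∈ S, ∀ b ∈ S, ¬ G.Adj a b

/-- `G^⋆`: the graph with vertex set `V(G) ∪ {z⋆}` (the new vertex `z⋆` is `none`) and
edge set `E(G) ∪ {vw, vz⋆, wz⋆} ∪ {z⋆u : u ∈ N(v) ∪ N(w)}`. -/
def Gstar {V : Type*} (G : SimpleGraph V) (v w : V) : SimpleGraph (Option V) :=
  SimpleGraph.fromRel (fun a b =>
    (∃ a' b' : V, a = some a' ∧ b = some b' ∧ (G.Adj a' b' ∨ (a' = v ∧ b' = w))) ∨
    (a = none ∧ ∃ u : V, b = some u ∧ (u = v ∨ u = w ∨ G.Adj v u ∨ G.Adj w u)))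

/-- Forget the extra vertex: extract the `V`-elements of a set of vertices of `G^⋆`. -/
def downOpt {V : Type*} [DecidableEq V] (S : Finset (Option V)) : Finset V :=
  S.biUnion (fun o => o.elim ∅ (fun a => {a}))

theorem mem_downOpt {V : Type*} [DecidableEq V] {S : Finset (Option V)} {a : V} :
    a ∈ downOpt S ↔ some a ∈ S := by
  simp only [downOpt, Finset.mem_biUnion]
  constructor
  · rintro ⟨_ | b, hb, ha⟩
    · simp at ha
    · obtain rfl : a = b := by simpa using ha
      exact hb
  · intro h
    exact ⟨some a, h, by simp⟩

theorem Gstar_adj_some_some {V : Type*} {G : SimpleGraph V} {v w : V} (hvw : v ≠ w) {a b : V} :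
    (Gstar G v w).Adj (some a) (some b) ↔
      G.Adj a b ∨ (a = v ∧ b = w) ∨ (a = w ∧ b = v) := by
  have hne : G.Adj a b → a ≠ b := fun h => h.ne
  have hsymm : G.Adj a b ↔ G.Adj b a := G.adj_comm a b
  simp [Gstar, SimpleGraph.fromRel_adj]
  grind

theorem Gstar_adj_none_some {V : Type*} {G : SimpleGraph V} {v w a : V} :
    (Gstar G v w).Adj none (some a) ↔ a = v ∨ a = w ∨ G.Adj v a ∨ G.Adj w a := by
  simp [Gstar, SimpleGraph.fromRel_adj]

/-- The stable sets of `G^⋆` avoiding the new vertex. -/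
theorem isStableSet_Gstar_iff_of_none_notMem {V : Type*} {G : SimpleGraph V} {v w : V}
    (hvw : v ≠ w) {S : Finset (Option V)} (hS : none ∉ S) :
    IsStableSet (Gstar G v w) S ↔
      (∀ a b, some a ∈ S → some b ∈ S → ¬ G.Adj a b) ∧ ¬ (some v ∈ S ∧ some w ∈ S) := by
  constructor
  · intro h
    refine ⟨fun a b ha hb hab => h _ ha _ hb ((Gstar_adj_some_some hvw).2 (Or.inl hab)), ?_⟩
    rintro ⟨hv, hw⟩
    exact h _ hv _ hw ((Gstar_adj_some_some hvw).2 (by simp))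
  · rintro ⟨h, hn⟩ (_ | a) ha (_ | b) hb hab
    · exact hS ha
    · exact hS ha
    · exact hS hb
    · rcases (Gstar_adj_some_some hvw).1 hab with h' | ⟨rfl, rfl⟩ | ⟨rfl, rfl⟩
      · exact h a b ha hb h'
      · exact hn ⟨ha, hb⟩
      · exact hn ⟨hb, ha⟩

/-- The stable sets of `G^⋆` containing the new vertex. -/
theorem isStableSet_Gstar_iff_of_none_mem {V : Type*} {G : SimpleGraph V} {v w : V}
    (hvw : v ≠ w) {S : Finset (Option V)} (hS : none ∈ S) :
    IsStableSet (Gstar G v w) S ↔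
      (∀ a b, some a ∈ S → some b ∈ S → ¬ G.Adj a b) ∧
        ∀ a, some a ∈ S → a ≠ v ∧ a ≠ w ∧ ¬ G.Adj v a ∧ ¬ G.Adj w a := by
  constructor
  · intro h
    refine ⟨fun a b ha hb hab => h _ ha _ hb ((Gstar_adj_some_some hvw).2 (Or.inl hab)), ?_⟩
    intro a ha
    have := h _ hS _ ha
    rw [Gstar_adj_none_some] at this
    tauto
  · rintro ⟨h, hn⟩ (_ | a) ha (_ | b) hb hab
    · exact hab.ne rfl
    · have := hn b hb
      rw [Gstar_adj_none_some] at hab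
      tauto
    · have := hn a ha
      rw [SimpleGraph.adj_comm, Gstar_adj_none_some] at hab
      tauto
    · rcases (Gstar_adj_some_some hvw).1 hab with h' | ⟨rfl, rfl⟩ | ⟨rfl, rfl⟩
      · exact h a b ha hb h'
      · exact (hn _ ha).1 rfl
      · exact (hn _ hb).1 rfl

theorem isStableSet_Gstar_iff_exists_image {V : Type*} [DecidableEq V] {G : SimpleGraph V}
    {v w : V} (hvw : v ≠ w) {S : Finset (Option V)} (hS : none ∉ S) :
    IsStableSet (Gstar G v w) S ↔
      ∃ T : Finset V, IsStableSet G T ∧ ¬ (v ∈ T ∧ w ∈ T) ∧ S = T.image some := by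
  rw [isStableSet_Gstar_iff_of_none_notMem hvw hS]
  constructor
  · rintro ⟨h, hn⟩
    refine ⟨downOpt S, fun a ha b hb => h a b (mem_downOpt.1 ha) (mem_downOpt.1 hb), ?_, ?_⟩
    · simpa only [mem_downOpt] using hn
    · ext (_ | a)
      · simp [hS]
      · simp [mem_downOpt]
  · rintro ⟨T, hT, hn, rfl⟩
    refine ⟨fun a b ha hb => hT a (by simpa using ha) b (by simpa using hb), ?_⟩
    simpa using hn

theorem bijOn_stableSets_Gstar {V : Type*} [DecidableEq V] {G : SimpleGraph V} {v w : V}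
    (hvw : v ≠ w) (hnadj : ¬ G.Adj v w) :
    Set.BijOn (fun S : Finset (Option V) => downOpt (S.erase none) ∪ {v, w})
      {S | IsStableSet (Gstar G v w) S ∧ none ∈ S}
      {T : Finset V | IsStableSet G T ∧ v ∈ T ∧ w ∈ T} := by
  have mem_iff (S : Finset (Option V)) (a : V) :
      a ∈ downOpt (S.erase none) ∪ {v, w} ↔ some a ∈ S ∨ a = v ∨ a = w := by
    simp [mem_downOpt]
    tauto
  refine ⟨?_, ?_, ?_⟩
  · rintro S ⟨hS, hz⟩
    obtain ⟨h, hn⟩ := (isStableSet_Gstar_iff_of_none_mem hvw hz).1 hS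
    refine ⟨?_, (mem_iff S v).2 (by simp), (mem_iff S w).2 (by simp)⟩
    intro a ha b hb hab
    rw [mem_iff] at ha hb
    rcases ha with ha | rfl | rfl <;> rcases hb with hb | rfl | rfl
    · exact h a b ha hb hab
    · exact (hn a ha).2.2.1 hab.symm
    · exact (hn a ha).2.2.2 hab.symm
    · exact (hn b hb).2.2.1 hab
    · exact hab.ne rfl
    · exact hnadj hab
    · exact (hn b hb).2.2.2 hab
    · exact hnadj hab.symm
    · exact hab.ne rfl
  · rintro S ⟨hS, hz⟩ S' ⟨hS', hz'⟩ heq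
    obtain ⟨-, hn⟩ := (isStableSet_Gstar_iff_of_none_mem hvw hz).1 hS
    obtain ⟨-, hn'⟩ := (isStableSet_Gstar_iff_of_none_mem hvw hz').1 hS'
    ext (_ | a)
    · simp [hz, hz']
    · have key := Finset.ext_iff.1 heq a
      simp only [mem_iff] at key
      have := hn a
      have := hn' a
      tauto
  · rintro T ⟨hT, hv, hw⟩
    let S : Finset (Option V) := insert none (((T.erase v).erase w).image some)
    have hz : none ∈ S := by simp [S]
    have memS (a : V) : some a ∈ S ↔ a ≠ w ∧ a ≠ v ∧ a ∈ T := by simp [S]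
    refine ⟨S, ⟨(isStableSet_Gstar_iff_of_none_mem hvw hz).2 ⟨?_, ?_⟩, hz⟩, ?_⟩
    · intro a b ha hb
      exact hT a ((memS a).1 ha).2.2 b ((memS b).1 hb).2.2
    · intro a ha
      obtain ⟨haw, hav, haT⟩ := (memS a).1 ha
      exact ⟨hav, haw, hT v hv a haT, hT w hw a haT⟩
    · ext a
      rw [mem_iff, memS]
      constructor
      · rintro (h | rfl | rfl)
        exacts [h.2.2, hv, hw]
      · tauto

/-- `G^⋆` has exactly as many stable sets as `G`: stable sets of `G^⋆` not containing
`z⋆` are (images of) stable sets of `G` not containing both `v` and `w`, and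
`S ↦ (S \ {z⋆}) ∪ {v, w}` bijects stable sets of `G^⋆` containing `z⋆` with stable
sets of `G` containing both `v` and `w`. -/
theorem stableSets_Gstar {V : Type*} [Fintype V] [DecidableEq V]
    (G : SimpleGraph V) (v w : V) (hvw : v ≠ w) (hnadj : ¬ G.Adj v w) :
    (Finset.univ.filter (fun S : Finset (Option V) => IsStableSet (Gstar G v w) S)).card
        = (Finset.univ.filter (fun S : Finset V => IsStableSet G S)).card ∧
    (∀ S : Finset (Option V), none ∉ S →
      (IsStableSet (Gstar G v w) S ↔
        ∃ T : Finset V, IsStableSet G T ∧ ¬(v ∈ T ∧ w ∈ T) ∧ S = T.image some)) ∧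
    Set.BijOn (fun S : Finset (Option V) => downOpt (S.erase none) ∪ {v, w})
      {S | IsStableSet (Gstar G v w) S ∧ none ∈ S}
      {T : Finset V | IsStableSet G T ∧ v ∈ T ∧ w ∈ T} := by
  have himage : ∀ S : Finset (Option V), none ∉ S →
      (IsStableSet (Gstar G v w) S ↔
        ∃ T : Finset V, IsStableSet G T ∧ ¬(v ∈ T ∧ w ∈ T) ∧ S = T.image some) :=
    fun S hS => isStableSet_Gstar_iff_exists_image hvw hS
  have hbij := bijOn_stableSets_Gstar (G := G) hvw hnadj
  refine ⟨?_, himage, hbij⟩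
  rw [← Finset.card_filter_add_card_filter_not (fun S : Finset (Option V) => none ∈ S),
    ← Finset.card_filter_add_card_filter_not (s := Finset.univ.filter (IsStableSet G))
      (fun T : Finset V => v ∈ T ∧ w ∈ T)]
  simp only [Finset.filter_filter]
  congr 1
  · refine Finset.card_nbij (fun S : Finset (Option V) => downOpt (S.erase none) ∪ {v, w}) ?_ ?_ ?_
    · intro S hS
      simpa using hbij.mapsTo (by simpa using hS)
    · simpa using hbij.injOn
    · simpa using hbij.surjOn
  · symm
    refine Finset.card_bij (fun T _ => T.image some) ?_ ?_ ?_
    · intro T hT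
      simp only [Finset.mem_filter, Finset.mem_univ, true_and] at hT ⊢
      have hz : none ∉ T.image some := by simp
      exact ⟨(himage _ hz).2 ⟨T, hT.1, hT.2, rfl⟩, hz⟩
    · intro T _ T' _ h
      exact Finset.image_injective (Option.some_injective V) h
    · intro S hS
      simp only [Finset.mem_filter, Finset.mem_univ, true_and] at hS
      obtain ⟨T, hT, hn, rfl⟩ := (himage S hS.2).1 hS.1
      exact ⟨T, by simpa using ⟨hT, not_and.1 hn⟩, rfl⟩
end
end

section
/- Let (G, ω) be a vertex-weighted graph and v, w distinct non-adjacent vertices with e = vw. The map sending a proper set coloring κ of G with κ(v) = κ(w) to the coloring κ/e of G/e defined by (κ/e)(z_{vw}) = κ(v) and (κ/e)(u) = κ(u) otherwise is a bijection from proper set colorings of G with κ(v) = κ(w) to all proper set colorings of G/e, and it preserves the associated monomial: Π_{u ∈ V(G)} (Π_{i ∈ κ(u)} x_i)^{ω(u)} = Π_{u ∈ V(G/e)} (Π_{i ∈ (κ/e)(u)} x_i)^{(ω/e)(u)}. -/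
open scoped Classical

noncomputable section

/-- A proper set coloring assigns to each vertex a nonempty finite set of colors
(positive integers, here indexed by `ℕ`) such that adjacent vertices get disjoint sets. -/
def IsProperSetColoring {V : Type*} (G : SimpleGraph V) (κ : V → Finset ℕ) : Prop :=
  (∀ v, (κ v).Nonempty) ∧ ∀ ⦃u v : V⦄, G.Adj u v → Disjoint (κ u) (κ v)

/-- The exponent vector of the monomial `∏_v (∏_{i ∈ κ v} x_i)^(ω v)`. -/
def setColWeight {V : Type*} [Fintype V] (ω : V → ℕ) (κ : V → Finset ℕ) : ℕ →₀ ℕ :=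
  ∑ v : V, ω v • (κ v).sum (fun i => Finsupp.single i 1)

/-- The (vertex-weighted) Kromatic symmetric function, as a power series in
`x_0, x_1, x_2, …`: the coefficient of a monomial is the number of proper set
colorings producing that monomial. -/
def kromatic {V : Type*} [Fintype V] (G : SimpleGraph V) (ω : V → ℕ) :
    MvPowerSeries ℕ ℤ :=
  fun d => (Nat.card {κ : V → Finset ℕ //
    IsProperSetColoring G κ ∧ setColWeight ω κ = d} : ℤ)

/-- The contraction `G/e` for `e = vw`: the vertices `v, w` are replaced by a single
new vertex (here `none`), adjacent to all neighbors of `v` and of `w`. -/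
def contractVW {V : Type*} (G : SimpleGraph V) (v w : V) :
    SimpleGraph (Option {u : V // u ≠ v ∧ u ≠ w}) :=
  SimpleGraph.fromRel (fun a b =>
    (∃ a' b' : {u : V // u ≠ v ∧ u ≠ w}, a = some a' ∧ b = some b' ∧ G.Adj a'.1 b'.1) ∨
    (a = none ∧ ∃ u : {u : V // u ≠ v ∧ u ≠ w}, b = some u ∧ (G.Adj v u.1 ∨ G.Adj w u.1)))

/-- The weight function `ω/e` on `G/e`: the contracted vertex gets weight `ω v + ω w`. -/
def contractWeight {V : Type*} (ω : V → ℕ) (v w : V) :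
    Option {u : V // u ≠ v ∧ u ≠ w} → ℕ :=
  fun o => o.elim (ω v + ω w) (fun a => ω a.1)

/-- The coloring `κ/e` of `G/e` induced by a coloring `κ` of `G`: the contracted
vertex `z_{vw}` receives `κ v`, and every other vertex keeps its color set. -/
def contractColoring {V : Type*} (v w : V) (κ : V → Finset ℕ) :
    Option {u : V // u ≠ v ∧ u ≠ w} → Finset ℕ :=
  fun o => o.elim (κ v) (fun a => κ a.1)

section Contraction

variable {V : Type*} (G : SimpleGraph V) (v w : V)

theorem contractVW_adj_some_some (a b : {u : V // u ≠ v ∧ u ≠ w}) :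
    (contractVW G v w).Adj (some a) (some b) ↔ G.Adj a.1 b.1 := by
  simp only [contractVW, SimpleGraph.fromRel_adj, Option.some.injEq, reduceCtorEq, false_and,
    or_false, ne_eq]
  constructor
  · rintro ⟨-, ⟨_, _, rfl, rfl, h⟩ | ⟨_, _, rfl, rfl, h⟩⟩
    exacts [h, h.symm]
  · exact fun h => ⟨fun hab => h.ne (congrArg Subtype.val hab), Or.inl ⟨a, b, rfl, rfl, h⟩⟩

theorem contractVW_adj_none_some (b : {u : V // u ≠ v ∧ u ≠ w}) :
    (contractVW G v w).Adj none (some b) ↔ G.Adj v b.1 ∨ G.Adj w b.1 := by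
  simp only [contractVW, SimpleGraph.fromRel_adj, reduceCtorEq, false_and, and_false,
    exists_false, false_or, true_and, ne_eq, not_false_eq_true, or_false, Option.some.injEq,
    exists_eq_left']

theorem contractColoring_injOn :
    Set.InjOn (contractColoring v w) {κ : V → Finset ℕ | κ v = κ w} := by
  intro κ (hκ : κ v = κ w) μ (hμ : μ v = μ w) h
  have hv : κ v = μ v := congrFun h none
  funext u
  by_cases hu : u ≠ v ∧ u ≠ w
  · exact congrFun h (some ⟨u, hu⟩)
  · obtain rfl | rfl : u = v ∨ u = w := by tauto
    · exact hv
    · rw [← hκ, hv, hμ]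

/-- The coloring of `G` obtained from a coloring of `G/e` by giving both `v` and `w` the color
set of the contracted vertex. -/
def expandColoring (κ : Option {u : V // u ≠ v ∧ u ≠ w} → Finset ℕ) : V → Finset ℕ :=
  fun u => if h : u ≠ v ∧ u ≠ w then κ (some ⟨u, h⟩) else κ none

theorem expandColoring_left (κ : Option {u : V // u ≠ v ∧ u ≠ w} → Finset ℕ) :
    expandColoring v w κ v = κ none := by
  simp [expandColoring]

theorem expandColoring_right (κ : Option {u : V // u ≠ v ∧ u ≠ w} → Finset ℕ) :
    expandColoring v w κ w = κ none := by
  simp [expandColoring]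

theorem contractColoring_expandColoring
    (κ : Option {u : V // u ≠ v ∧ u ≠ w} → Finset ℕ) :
    contractColoring v w (expandColoring v w κ) = κ := by
  funext o
  rcases o with _ | a
  · exact expandColoring_left v w κ
  · exact dif_pos a.2

variable {G v w}

/-- For colorings with `κ v = κ w`, properness is equivalent to properness after contraction. -/
theorem isProperSetColoring_contractColoring_iff (hnadj : ¬ G.Adj v w) {κ : V → Finset ℕ}
    (hκ : κ v = κ w) :
    IsProperSetColoring (contractVW G v w) (contractColoring v w κ) ↔
      IsProperSetColoring G κ := by
  constructor
  · rintro ⟨hne, hdisj⟩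
    have hend : ∀ {a b : V}, a = v ∨ a = w → G.Adj a b → Disjoint (κ a) (κ b) := by
      intro a b ha hab
      have hb : b ≠ v ∧ b ≠ w := by
        rcases ha with rfl | rfl
        · exact ⟨hab.ne', by rintro rfl; exact hnadj hab⟩
        · exact ⟨by rintro rfl; exact hnadj hab.symm, hab.ne'⟩
      have hva : κ a = κ v := by
        rcases ha with rfl | rfl
        exacts [rfl, hκ.symm]
      rw [hva]
      refine hdisj ((contractVW_adj_none_some G v w ⟨b, hb⟩).2 ?_)
      rcases ha with rfl | rfl
      exacts [Or.inl hab, Or.inr hab]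
    refine ⟨fun u => ?_, fun a b hab => ?_⟩
    · by_cases hu : u ≠ v ∧ u ≠ w
      · exact hne (some ⟨u, hu⟩)
      · obtain rfl | rfl : u = v ∨ u = w := by tauto
        · exact hne none
        · exact hκ ▸ hne none
    · by_cases ha : a = v ∨ a = w
      · exact hend ha hab
      by_cases hb : b = v ∨ b = w
      · exact (hend hb hab.symm).symm
      exact hdisj ((contractVW_adj_some_some G v w ⟨a, not_or.1 ha⟩ ⟨b, not_or.1 hb⟩).2 hab)
  · rintro ⟨hne, hdisj⟩
    have hnone : ∀ b : {u : V // u ≠ v ∧ u ≠ w}, (contractVW G v w).Adj none (some b) →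
        Disjoint (κ v) (κ b.1) := by
      intro b hab
      rcases (contractVW_adj_none_some G v w b).1 hab with h | h
      · exact hdisj h
      · exact hκ ▸ hdisj h
    refine ⟨?_, ?_⟩
    · rintro (_ | a)
      exacts [hne v, hne a.1]
    · rintro (_ | a) (_ | b) hab
      · exact absurd rfl hab.ne
      · exact hnone b hab
      · exact (hnone a hab.symm).symm
      · exact hdisj ((contractVW_adj_some_some G v w a b).1 hab)

theorem sum_eq_add_add_sum_subtype [Fintype V] {M : Type*} [AddCommMonoid M] (hvw : v ≠ w)
    (f : V → M) :
    ∑ u, f u = f v + f w + ∑ a : {u : V // u ≠ v ∧ u ≠ w}, f a.1 := by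
  rw [← Finset.sum_pair hvw, ← Finset.sum_add_sum_compl {v, w} f]
  congr 1
  exact Finset.sum_subtype _ (by simp) f

theorem setColWeight_contractColoring [Fintype V] (ω : V → ℕ) (hvw : v ≠ w) {κ : V → Finset ℕ}
    (hκ : κ v = κ w) :
    setColWeight (contractWeight ω v w) (contractColoring v w κ) = setColWeight ω κ := by
  simp only [setColWeight]
  rw [Fintype.sum_option, sum_eq_add_add_sum_subtype hvw]
  simp only [contractWeight, contractColoring, Option.elim, add_smul, hκ]

end Contraction

/-- `κ ↦ κ/e` is a bijection from the proper set colorings of `G` with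
`κ(v) = κ(w)` onto all proper set colorings of `G/e`, and it preserves the
associated monomial. -/
theorem contractColoring_bijection {V : Type*} [Fintype V]
    (G : SimpleGraph V) (ω : V → ℕ) (v w : V) (hvw : v ≠ w) (hnadj : ¬ G.Adj v w) :
    Set.BijOn (contractColoring v w)
      {κ : V → Finset ℕ | IsProperSetColoring G κ ∧ κ v = κ w}
      {κ' | IsProperSetColoring (contractVW G v w) κ'} ∧
    (∀ κ : V → Finset ℕ, κ v = κ w →
      setColWeight ω κ =
        setColWeight (contractWeight ω v w) (contractColoring v w κ)) := by
  refine ⟨⟨?_, ?_, ?_⟩, fun κ hκ => (setColWeight_contractColoring ω hvw hκ).symm⟩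
  · exact fun κ hκ => (isProperSetColoring_contractColoring_iff hnadj hκ.2).2 hκ.1
  · exact (contractColoring_injOn v w).mono fun κ hκ => hκ.2
  · intro κ hκ
    have heq : expandColoring v w κ v = expandColoring v w κ w := by
      rw [expandColoring_left, expandColoring_right]
    refine ⟨expandColoring v w κ, ⟨?_, heq⟩, contractColoring_expandColoring v w κ⟩
    rw [← isProperSetColoring_contractColoring_iff hnadj heq, contractColoring_expandColoring]
    exact hκ
end
end

section
/- Let (G, ω) be a vertex-weighted graph and v, w distinct non-adjacent vertices. The map sending a proper set coloring κ of G with κ(v) ⊊ κ(w) to the coloring κ^1 of G^1 defined by κ^1(v) = κ(v), κ^1(w) = κ(w) \ κ(v), and κ^1(u) = κ(u) otherwise is a bijection from proper set colorings of G with κ(v) ⊊ κ(w) to all proper set colorings of G^1, and it preserves the associated monomial: Π_{u ∈ V(G)} (Π_{i ∈ κ(u)} x_i)^{ω(u)} = Π_{u ∈ V(G^1)} (Π_{i ∈ κ^1(u)} x_i)^{ω^1(u)}. -/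
open scoped Classical

noncomputable section

/-- `G^1`: the graph with vertex set `V(G)` and edge set
`E(G) ∪ {vw} ∪ {vu : u ∈ N(w)}`. -/
def Gone {V : Type*} (G : SimpleGraph V) (v w : V) : SimpleGraph V :=
  G ⊔ SimpleGraph.fromRel (fun a b => a = v ∧ (b = w ∨ G.Adj w b))

/-- The weight function `ω¹` on `G^1`: the vertex `v` gets weight `ω v + ω w`. -/
def oneWeight {V : Type*} [DecidableEq V] (ω : V → ℕ) (v w : V) : V → ℕ :=
  fun u => if u = v then ω v + ω w else ω u

/-- The coloring `κ¹` of `G^1` induced by a coloring `κ` of `G`: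
`κ¹(v) = κ(v)`, `κ¹(w) = κ(w) \ κ(v)`, and all other color sets are kept. -/
def oneColoring {V : Type*} [DecidableEq V] (v w : V) (κ : V → Finset ℕ) :
    V → Finset ℕ :=
  fun u => if u = w then κ w \ κ v else κ u

theorem isProperSetColoring_Gone_iff {V : Type*} {G : SimpleGraph V} {v w : V} (hvw : v ≠ w)
    (hnadj : ¬ G.Adj v w) {κ : V → Finset ℕ} :
    IsProperSetColoring (Gone G v w) κ ↔
      IsProperSetColoring G κ ∧ Disjoint (κ v) (κ w) ∧
        ∀ u, G.Adj w u → Disjoint (κ v) (κ u) := by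
  have hadj (a b : V) : (Gone G v w).Adj a b ↔ G.Adj a b ∨ (a ≠ b ∧
      ((a = v ∧ (b = w ∨ G.Adj w b)) ∨ (b = v ∧ (a = w ∨ G.Adj w a)))) := by
    simp [Gone]
  constructor
  · rintro ⟨hne, hdisj⟩
    refine ⟨⟨hne, fun a b h => hdisj ((hadj a b).2 (Or.inl h))⟩,
      hdisj ((hadj v w).2 (Or.inr ⟨hvw, Or.inl ⟨rfl, Or.inl rfl⟩⟩)), fun u hu => ?_⟩
    have hvu : v ≠ u := fun h => hnadj (h ▸ hu.symm)
    exact hdisj ((hadj v u).2 (Or.inr ⟨hvu, Or.inl ⟨rfl, Or.inr hu⟩⟩))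
  · rintro ⟨⟨hne, hdisj⟩, hd, hn⟩
    refine ⟨hne, fun a b h => ?_⟩
    rcases (hadj a b).1 h with h | ⟨-, ⟨rfl, rfl | h⟩ | ⟨rfl, rfl | h⟩⟩
    · exact hdisj h
    · exact hd
    · exact hn b h
    · exact hd.symm
    · exact (hn a h).symm

theorem IsProperSetColoring.of_subset {V : Type*} {G : SimpleGraph V} {κ κ' : V → Finset ℕ}
    (h : IsProperSetColoring G κ) (hne : ∀ u, (κ' u).Nonempty) (hsub : ∀ u, κ' u ⊆ κ u) :
    IsProperSetColoring G κ' :=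
  ⟨hne, fun a b hab => (h.2 hab).mono (hsub a) (hsub b)⟩

theorem oneColoring_self {V : Type*} [DecidableEq V] (v w : V) (κ : V → Finset ℕ) :
    oneColoring v w κ w = κ w \ κ v := if_pos rfl

theorem oneColoring_of_ne {V : Type*} [DecidableEq V] (v : V) {w u : V} (κ : V → Finset ℕ)
    (h : u ≠ w) : oneColoring v w κ u = κ u := if_neg h

theorem oneColoring_subset {V : Type*} [DecidableEq V] (v w : V) (κ : V → Finset ℕ) (u : V) :
    oneColoring v w κ u ⊆ κ u := by
  by_cases h : u = w
  · subst h
    rw [oneColoring_self]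
    exact Finset.sdiff_subset
  · rw [oneColoring_of_ne v κ h]

theorem mapsTo_oneColoring {V : Type*} [DecidableEq V] {G : SimpleGraph V} {v w : V}
    (hvw : v ≠ w) (hnadj : ¬ G.Adj v w) :
    Set.MapsTo (oneColoring v w) {κ : V → Finset ℕ | IsProperSetColoring G κ ∧ κ v ⊂ κ w}
      {κ' | IsProperSetColoring (Gone G v w) κ'} := by
  rintro κ ⟨hκ, hss⟩
  refine (isProperSetColoring_Gone_iff hvw hnadj).2
    ⟨hκ.of_subset (fun u => ?_) (oneColoring_subset v w κ), ?_, fun u hu => ?_⟩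
  · by_cases h : u = w
    · subst h
      rw [oneColoring_self]
      exact Finset.sdiff_nonempty.2 hss.2
    · rw [oneColoring_of_ne v κ h]
      exact hκ.1 u
  · rw [oneColoring_self, oneColoring_of_ne v κ hvw]
    exact Finset.disjoint_sdiff
  · exact (hκ.2 hu).mono ((oneColoring_subset v w κ v).trans hss.1) (oneColoring_subset v w κ u)

theorem injOn_oneColoring {V : Type*} [DecidableEq V] {v w : V} (hvw : v ≠ w) :
    Set.InjOn (oneColoring v w) {κ : V → Finset ℕ | κ v ⊆ κ w} := by
  intro κ hκ μ hμ h
  have hne (u : V) (hu : u ≠ w) : κ u = μ u := by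
    simpa only [oneColoring_of_ne v _ hu] using congrFun h u
  funext u
  by_cases hu : u = w
  · subst hu
    have hw := congrFun h u
    rw [oneColoring_self, oneColoring_self] at hw
    rw [← Finset.sdiff_union_of_subset hκ, ← Finset.sdiff_union_of_subset hμ, hw, hne v hvw]
  · exact hne u hu

theorem surjOn_oneColoring {V : Type*} [DecidableEq V] {G : SimpleGraph V} {v w : V}
    (hvw : v ≠ w) (hnadj : ¬ G.Adj v w) :
    Set.SurjOn (oneColoring v w) {κ : V → Finset ℕ | IsProperSetColoring G κ ∧ κ v ⊂ κ w}
      {κ' | IsProperSetColoring (Gone G v w) κ'} := by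
  intro κ' hκ'
  obtain ⟨⟨hne, hdisj⟩, hd, hn⟩ := (isProperSetColoring_Gone_iff hvw hnadj).1 hκ'
  set κ := Function.update κ' w (κ' w ∪ κ' v) with hκ
  have hw : κ w = κ' w ∪ κ' v := Function.update_self ..
  have hu (u : V) (h : u ≠ w) : κ u = κ' u := Function.update_of_ne h ..
  have hwu (u : V) (h : G.Adj w u) : Disjoint (κ w) (κ u) := by
    rw [hw, hu u h.ne', Finset.disjoint_union_left]
    exact ⟨hdisj h, hn u h⟩
  refine ⟨κ, ⟨⟨fun u => ?_, fun a b hab => ?_⟩, ?_⟩, ?_⟩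
  · by_cases h : u = w
    · subst h
      exact hw ▸ (hne u).mono Finset.subset_union_left
    · exact hu u h ▸ hne u
  · by_cases ha : a = w
    · subst ha
      exact hwu b hab
    by_cases hb : b = w
    · subst hb
      exact (hwu a hab.symm).symm
    rw [hu a ha, hu b hb]
    exact hdisj hab
  · rw [hw, hu v hvw, Finset.ssubset_iff_subset_ne]
    refine ⟨Finset.subset_union_right, fun h => (hne w).ne_empty ?_⟩
    exact Finset.disjoint_self_iff_empty _ |>.1 (hd.mono_left (Finset.union_eq_right.1 h.symm))
  · funext u
    by_cases h : u = w
    · subst h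
      rw [oneColoring_self, hw, hu v hvw, Finset.union_sdiff_cancel_right hd.symm]
    · rw [oneColoring_of_ne v κ h, hu u h]

theorem setColWeight_oneColoring {V : Type*} [Fintype V] [DecidableEq V] (ω : V → ℕ) {v w : V}
    (hvw : v ≠ w) {κ : V → Finset ℕ} (hκ : κ v ⊆ κ w) :
    setColWeight (oneWeight ω v w) (oneColoring v w κ) = setColWeight ω κ := by
  have hw : w ∈ Finset.univ.erase v := Finset.mem_erase.2 ⟨hvw.symm, Finset.mem_univ w⟩
  unfold setColWeight
  simp only [← Finset.add_sum_erase _ _ (Finset.mem_univ v), ← Finset.add_sum_erase _ _ hw]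
  rw [oneColoring_self, oneColoring_of_ne v κ hvw, ← Finset.sum_sdiff hκ]
  have hrest : ∀ u ∈ (Finset.univ.erase v).erase w,
      oneWeight ω v w u • (oneColoring v w κ u).sum (fun i => Finsupp.single i 1) =
        ω u • (κ u).sum (fun i => Finsupp.single i 1) := by
    intro u hu
    simp only [Finset.mem_erase] at hu
    rw [oneColoring_of_ne v κ hu.1, oneWeight, if_neg hu.2.1]
  rw [Finset.sum_congr rfl hrest]
  simp only [oneWeight, if_true, if_neg hvw.symm, add_smul, smul_add]
  abel

/-- `κ ↦ κ¹` is a bijection from the proper set colorings of `G` with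
`κ(v) ⊊ κ(w)` onto all proper set colorings of `G^1`, and it preserves the
associated monomial. -/
theorem oneColoring_bijection {V : Type*} [Fintype V] [DecidableEq V]
    (G : SimpleGraph V) (ω : V → ℕ) (v w : V) (hvw : v ≠ w) (hnadj : ¬ G.Adj v w) :
    Set.BijOn (oneColoring v w)
      {κ : V → Finset ℕ | IsProperSetColoring G κ ∧ κ v ⊂ κ w}
      {κ' | IsProperSetColoring (Gone G v w) κ'} ∧
    (∀ κ : V → Finset ℕ, κ v ⊂ κ w →
      setColWeight ω κ = setColWeight (oneWeight ω v w) (oneColoring v w κ)) := by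
  exact ⟨⟨mapsTo_oneColoring hvw hnadj,
    (injOn_oneColoring hvw).mono fun _ h => h.2.1, surjOn_oneColoring hvw hnadj⟩,
    fun _ hκ => (setColWeight_oneColoring ω hvw hκ.1).symm⟩
end
end
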